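/- arXiv:1711.04724 — 3 statements merged into one kernel-verified Lean document; each statement's English description precedes it below -/
import Mathlib

section
/- Let E be an inner product module over a C*-algebra A and let x, y ∈ E. The following statements are mutually equivalent: (i) ⟨x, y⟩ = 0; (ii) |x − λy| = |x + λy| for all λ ∈ ℂ; (iii) |x − ay| = |x + ay| for all a ∈ A; (iv) |x|² ≤ |x + λy|² for all λ ∈ ℂ; (v) |x|² ≤ |x + ay|² for all a ∈ A; (vi) |x| ≤ |x + ay| for all a ∈ A. Here ≤ denotes the order of the C*-algebra A. -/
/-- An inner product module over a C*-algebra `A`: a (left) `A`-module `E` together with an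
`A`-valued inner product which is `ℂ`-linear and `A`-linear in the first variable, conjugate
symmetric, and positive definite. -/
structure CStarInnerProductModule (A E : Type*) [NonUnitalCStarAlgebra A]
    [PartialOrder A] [StarOrderedRing A]
    [AddCommGroup E] [Module ℂ E] [SMul A E] where
  inner : E → E → A
  add_left : ∀ x y z : E, inner (x + y) z = inner x z + inner y z
  smulC_left : ∀ (c : ℂ) (x y : E), inner (c • x) y = c • inner x y
  smulA_left : ∀ (a : A) (x y : E), inner (a • x) y = a * inner x y
  star_inner : ∀ x y : E, star (inner x y) = inner y x
  inner_self_nonneg : ∀ x : E, 0 ≤ inner x x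
  inner_self_eq_zero : ∀ x : E, inner x x = 0 ↔ x = 0
  smul_add : ∀ (a : A) (x y : E), a • (x + y) = a • x + a • y
  add_smul : ∀ (a b : A) (x : E), (a + b) • x = a • x + b • x
  mul_smul : ∀ (a b : A) (x : E), (a * b) • x = a • (b • x)
  smul_assoc : ∀ (c : ℂ) (a : A) (x : E), (c • a) • x = c • (a • x)

/-- The polarization step: `a` vanishes once the real parts of `a` and `-i a` do. -/
lemma eq_zero_of_add_star_smul_eq_zero {A : Type*} [AddCommGroup A] [StarAddMonoid A] [Module ℂ A]
    [StarModule ℂ A] {a : A} (h : ∀ c : ℂ, star c • a + star (star c • a) = 0) : a = 0 := by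
  have h₁ : a + star a = 0 := by simpa using h 1
  have h₂ : star a = a := by
    have := h Complex.I
    simp only [RCLike.star_def, Complex.conj_I, neg_smul, star_neg, star_smul, neg_neg,
      neg_add_eq_zero] at this
    exact (smul_right_injective A Complex.I_ne_zero this).symm
  rw [h₂, ← two_smul ℂ] at h₁
  exact (smul_eq_zero.1 h₁).resolve_left two_ne_zero

namespace CStarInnerProductModule

variable {A E : Type*} [NonUnitalCStarAlgebra A] [PartialOrder A] [StarOrderedRing A]
  [AddCommGroup E] [Module ℂ E] [SMul A E] (M : CStarInnerProductModule A E)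

lemma neg_left (x z : E) : M.inner (-x) z = -M.inner x z := by
  simpa using M.smulC_left (-1) x z

lemma add_right (x y z : E) : M.inner x (y + z) = M.inner x y + M.inner x z := by
  rw [← M.star_inner, M.add_left, star_add, M.star_inner, M.star_inner]

lemma neg_right (x z : E) : M.inner x (-z) = -M.inner x z := by
  rw [← M.star_inner, M.neg_left, star_neg, M.star_inner]

lemma inner_smulC_right (c : ℂ) (x y : E) : M.inner x (c • y) = star c • M.inner x y := by
  rw [← M.star_inner, M.smulC_left, star_smul, M.star_inner]

lemma inner_smulA_right (a : A) (x y : E) : M.inner x (a • y) = M.inner x y * star a := by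
  rw [← M.star_inner, M.smulA_left, star_mul, M.star_inner]

lemma inner_add_self (x z : E) : M.inner (x + z) (x + z) =
    M.inner x x + (M.inner x z + star (M.inner x z)) + M.inner z z := by
  rw [M.add_left, M.add_right, M.add_right, M.star_inner]
  abel

lemma inner_sub_self (x z : E) : M.inner (x - z) (x - z) =
    M.inner x x - (M.inner x z + star (M.inner x z)) + M.inner z z := by
  rw [sub_eq_add_neg, M.inner_add_self]
  simp only [M.neg_left, M.neg_right, star_neg, neg_neg]
  abel

lemma sqrt_inner_sub_eq_sqrt_inner_add_iff (x z : E) :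
    CFC.sqrt (M.inner (x - z) (x - z)) = CFC.sqrt (M.inner (x + z) (x + z)) ↔
      M.inner x z + star (M.inner x z) = 0 := by
  have : CFC.sqrt (M.inner (x - z) (x - z)) = CFC.sqrt (M.inner (x + z) (x + z)) ↔
      M.inner (x - z) (x - z) = M.inner (x + z) (x + z) := by
    refine ⟨fun h ↦ ?_, fun h ↦ by rw [h]⟩
    rw [← CFC.sqrt_mul_sqrt_self _ (M.inner_self_nonneg (x - z)), h,
      CFC.sqrt_mul_sqrt_self _ (M.inner_self_nonneg (x + z))]
  rw [this, M.inner_sub_self, M.inner_add_self, add_left_inj, sub_eq_add_neg, add_right_inj,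
    neg_eq_iff_add_eq_zero, ← two_smul ℂ, smul_eq_zero_iff_right two_ne_zero]

lemma inner_self_le_inner_add_self {x z : E} (h : M.inner x z = 0) :
    M.inner x x ≤ M.inner (x + z) (x + z) := by
  simpa [M.inner_add_self, h] using M.inner_self_nonneg z

lemma inner_eq_zero_of_forall_inner_self_le {x y : E}
    (h : ∀ c : ℂ, M.inner x x ≤ M.inner (x + c • y) (x + c • y)) : M.inner x y = 0 := by
  have key (c : ℂ) : 0 ≤ star c • M.inner x y + star (star c • M.inner x y) := by
    have hlim : Filter.Tendsto (fun t : ℝ ↦ star c • M.inner x y + star (star c • M.inner x y) +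
        t • (star c • c • M.inner y y)) (nhdsWithin 0 (Set.Ioi 0))
        (nhds (star c • M.inner x y + star (star c • M.inner x y))) := by
      have : Continuous fun t : ℝ ↦ star c • M.inner x y + star (star c • M.inner x y) +
        t • (star c • c • M.inner y y) := by fun_prop
      simpa using (this.tendsto 0).mono_left nhdsWithin_le_nhds
    refine ge_of_tendsto hlim ?_
    filter_upwards [self_mem_nhdsWithin] with t (ht : 0 < t)
    have := h ((t : ℂ) * c)
    rw [M.inner_add_self, add_assoc, le_add_iff_nonneg_right] at this
    refine (smul_nonneg_iff_nonneg_of_pos_left ht).1 ?_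
    convert this using 1
    simp only [M.inner_smulC_right, M.smulC_left, star_mul, star_smul,
      ← Complex.coe_smul, RCLike.star_def, Complex.conj_ofReal]
    module
  refine eq_zero_of_add_star_smul_eq_zero fun c ↦ le_antisymm ?_ (key c)
  have := key (-c)
  simpa [-neg_add_rev, ← neg_add] using this

/-- For small `t > 0` the choice `a = -t⟨x, y⟩` gives `|x + ay|² ≤ |x|² - t⟨x, y⟩⟨x, y⟩*`. -/
lemma inner_eq_zero_of_forall_sqrt_inner_self_le {x y : E}
    (h : ∀ a : A, CFC.sqrt (M.inner x x) ≤ CFC.sqrt (M.inner (x + a • y) (x + a • y))) :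
    M.inner x y = 0 := by
  set b := M.inner x y with hb
  obtain ⟨t, ht, htb⟩ : ∃ t : ℝ, 0 < t ∧ t * ‖M.inner y y‖ ≤ 1 := by
    refine ⟨1 / (‖M.inner y y‖ + 1), by positivity, ?_⟩
    rw [div_mul_eq_mul_div, div_le_one (by positivity)]
    linarith
  have hbb : 0 ≤ b * star b := mul_star_self_nonneg b
  have hle : M.inner (x + (-(t • b)) • y) (x + (-(t • b)) • y) ≤
      M.inner x x - t • (b * star b) := by
    have h₁ : b * M.inner y y * star b ≤ ‖M.inner y y‖ • (b * star b) :=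
      CStarAlgebra.star_right_conjugate_le_norm_smul (.of_nonneg (M.inner_self_nonneg y))
    have h₂ : (t * t) • (b * M.inner y y * star b) ≤ t • (b * star b) := calc
      _ ≤ (t * t) • (‖M.inner y y‖ • (b * star b)) := smul_le_smul_of_nonneg_left h₁ (by positivity)
      _ = (t * (t * ‖M.inner y y‖)) • (b * star b) := by rw [smul_smul, mul_assoc]
      _ ≤ t • (b * star b) := smul_le_smul_of_nonneg_right (by nlinarith) hbb
    have h₃ : M.inner (x + (-(t • b)) • y) (x + (-(t • b)) • y) =
        M.inner x x - (2 * t) • (b * star b) + (t * t) • (b * M.inner y y * star b) := by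
      rw [M.inner_add_self]
      simp only [M.inner_smulA_right, M.smulA_left, ← hb, star_neg, star_smul, star_mul, star_star,
        mul_neg, neg_mul, mul_smul_comm, smul_mul_assoc, star_trivial, mul_assoc]
      module
    rw [h₃]
    calc _ ≤ M.inner x x - (2 * t) • (b * star b) + t • (b * star b) := by gcongr
      _ = _ := by module
  have hle' := hle.trans (sub_le_self _ (smul_nonneg ht.le hbb))
  have heq := le_antisymm (h (-(t • b))) (CFC.sqrt_le_sqrt _ _ hle')
  have heq' : M.inner x x = M.inner (x + (-(t • b)) • y) (x + (-(t • b)) • y) := by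
    rw [← CFC.sqrt_mul_sqrt_self _ (M.inner_self_nonneg x), heq,
      CFC.sqrt_mul_sqrt_self _ (M.inner_self_nonneg _)]
  rw [← heq', le_sub_self_iff] at hle
  have h₀ : t • (b * star b) = 0 := le_antisymm hle (smul_nonneg ht.le hbb)
  exact (CStarRing.mul_star_self_eq_zero_iff b).1 ((smul_eq_zero.1 h₀).resolve_left ht.ne')

end CStarInnerProductModule

/-- **Lemma 3.1**: characterizations of orthogonality in an inner product `C*`-module.
Here `|x| = CFC.sqrt ⟪x, x⟫` is the `A`-valued norm, so that `|x|² = ⟪x, x⟫`. -/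
theorem orthogonality_characterizations
    {A E : Type*} [NonUnitalCStarAlgebra A] [PartialOrder A] [StarOrderedRing A]
    [AddCommGroup E] [Module ℂ E] [SMul A E]
    (M : CStarInnerProductModule A E) (x y : E) :
    List.TFAE
      [ M.inner x y = 0,
        ∀ lam : ℂ, CFC.sqrt (M.inner (x - lam • y) (x - lam • y)) =
          CFC.sqrt (M.inner (x + lam • y) (x + lam • y)),
        ∀ a : A, CFC.sqrt (M.inner (x - a • y) (x - a • y)) =
          CFC.sqrt (M.inner (x + a • y) (x + a • y)),
        ∀ lam : ℂ, M.inner x x ≤ M.inner (x + lam • y) (x + lam • y),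
        ∀ a : A, M.inner x x ≤ M.inner (x + a • y) (x + a • y),
        ∀ a : A, CFC.sqrt (M.inner x x) ≤ CFC.sqrt (M.inner (x + a • y) (x + a • y)) ] := by
  tfae_have 1 → 2 := fun h lam ↦ by
    rw [M.sqrt_inner_sub_eq_sqrt_inner_add_iff]
    simp [M.inner_smulC_right, h]
  tfae_have 2 → 1 := fun h ↦ eq_zero_of_add_star_smul_eq_zero fun c ↦ by
    rw [← M.inner_smulC_right, ← M.sqrt_inner_sub_eq_sqrt_inner_add_iff]
    exact h c
  tfae_have 1 → 3 := fun h a ↦ by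
    rw [M.sqrt_inner_sub_eq_sqrt_inner_add_iff]
    simp [M.inner_smulA_right, h]
  tfae_have 3 → 1 := fun h ↦ by
    have := h (M.inner x y)
    rw [M.sqrt_inner_sub_eq_sqrt_inner_add_iff, M.inner_smulA_right, star_mul, star_star,
      ← two_smul ℂ] at this
    exact (CStarRing.mul_star_self_eq_zero_iff _).1 ((smul_eq_zero.1 this).resolve_left two_ne_zero)
  tfae_have 1 → 4 := fun h lam ↦
    M.inner_self_le_inner_add_self (by simp [M.inner_smulC_right, h])
  tfae_have 4 → 1 := M.inner_eq_zero_of_forall_inner_self_le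
  tfae_have 1 → 5 := fun h a ↦
    M.inner_self_le_inner_add_self (by simp [M.inner_smulA_right, h])
  tfae_have 5 → 6 := fun h a ↦ CFC.sqrt_le_sqrt _ _ (h a)
  tfae_have 6 → 1 := M.inner_eq_zero_of_forall_sqrt_inner_self_le
  tfae_finish
end

section
/- Let A be a standard C*-algebra on a Hilbert space H and let E be a nonzero A-module carrying two A-valued inner products ⟨·,·⟩₁ and ⟨·,·⟩₂, each making E an inner product A-module. If ⟨x, y⟩₁ = 0 implies ⟨x, y⟩₂ = 0 for all x, y ∈ E, then there exists a positive real constant γ such that ⟨x, y⟩₂ = γ·⟨x, y⟩₁ for all x, y ∈ E. -/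
/-- If orthogonality for one Hermitian form implies orthogonality for another, and isotropic
vectors of the first form lie in its radical, then the second form is a multiple of the first. -/
theorem exists_eq_mul_of_orthogonal_imp {E : Type*} [AddCommGroup E] [Module ℂ E]
    (f g : E → E → ℂ)
    (f_add : ∀ x y z, f (x + y) z = f x z + f y z)
    (f_smul : ∀ (c : ℂ) x y, f (c • x) y = c * f x y)
    (f_star : ∀ x y, star (f x y) = f y x)
    (g_add : ∀ x y z, g (x + y) z = g x z + g y z)
    (g_smul : ∀ (c : ℂ) x y, g (c • x) y = c * g x y)
    (g_star : ∀ x y, star (g x y) = g y x)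
    (f_radical : ∀ x y, f y y = 0 → f x y = 0)
    (hfg : ∀ x y, f x y = 0 → g x y = 0) :
    ∃ c : ℂ, ∀ x y, g x y = c * f x y := by
  have f_add_right (x y z) : f x (y + z) = f x y + f x z := by
    rw [← f_star, f_add, star_add, f_star, f_star]
  have key (x y) (hy : f y y ≠ 0) : g x y = g y y / f y y * f x y := by
    have h0 := hfg (x + (-(f x y / f y y)) • y) y (by rw [f_add, f_smul]; field_simp; ring)
    rw [g_add, g_smul] at h0
    linear_combination h0
  have real (y) : star (g y y / f y y) = g y y / f y y := by
    rw [star_div₀, f_star, g_star]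
  have ratio_eq (x y) (hx : f x x ≠ 0) (hy : f y y ≠ 0) (hxy : f x y ≠ 0) :
      g x x / f x x = g y y / f y y := by
    have h1 := congrArg star (key y x hx)
    rw [star_mul', real, f_star, g_star, key x y hy] at h1
    exact (mul_right_cancel₀ hxy h1).symm
  have ratio_const (x y) (hx : f x x ≠ 0) (hy : f y y ≠ 0) :
      g x x / f x x = g y y / f y y := by
    by_cases hxy : f x y = 0
    · have hyx : f y x = 0 := by rw [← f_star, hxy, star_zero]
      have h1 : f x (x + y) ≠ 0 := by rwa [f_add_right, hxy, add_zero]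
      have h2 : f y (x + y) ≠ 0 := by rwa [f_add_right, hyx, zero_add]
      have h3 : f (x + y) (x + y) ≠ 0 := fun h ↦ h1 (f_radical _ _ h)
      rw [ratio_eq x _ hx h3 h1, ratio_eq y _ hy h3 h2]
    · exact ratio_eq x y hx hy hxy
  by_cases hf : ∃ u, f u u ≠ 0
  · obtain ⟨u, hu⟩ := hf
    refine ⟨g u u / f u u, fun x y ↦ ?_⟩
    by_cases hy : f y y = 0
    · have hxy := f_radical x y hy
      rw [hfg x y hxy, hxy, mul_zero]
    · rw [key x y hy, ratio_const y u hy hu]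
  · push Not at hf
    exact ⟨0, fun x y ↦ by rw [hfg x y (f_radical x y (hf y)), zero_mul]⟩

theorem isCompactOperator_rankOne {H : Type*} [NormedAddCommGroup H] [InnerProductSpace ℂ H]
    (x y : H) : IsCompactOperator (InnerProductSpace.rankOne ℂ x y) :=
  (isCompactOperator_of_locallyCompactSpace_dom (innerSL ℂ y)).clm_comp
    (ContinuousLinearMap.toSpanSingleton ℂ x)

namespace CStarInnerProductModule

open InnerProductSpace

variable {A E : Type*} [NonUnitalCStarAlgebra A] [PartialOrder A] [StarOrderedRing A]
  [AddCommGroup E] [Module ℂ E] [SMul A E]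

theorem inner_zero_left (M : CStarInnerProductModule A E) (x : E) : M.inner 0 x = 0 := by
  simpa using M.smulC_left 0 0 x

theorem inner_zero_right (M : CStarInnerProductModule A E) (x : E) : M.inner x 0 = 0 := by
  rw [← M.star_inner, M.inner_zero_left, star_zero]

theorem inner_smul_smul (M : CStarInnerProductModule A E) (a b : A) (x y : E) :
    M.inner (a • x) (b • y) = a * M.inner x y * star b := by
  rw [M.smulA_left, ← M.star_inner (b • y) x, M.smulA_left, star_mul, M.star_inner, mul_assoc]

variable {H : Type*} [NormedAddCommGroup H] [InnerProductSpace ℂ H] [CompleteSpace H]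

/-- The scalar form `(x, y) ↦ ⟪ξ, π ⟪x, y⟫ ξ⟫` attached to a vector `ξ`. -/
noncomputable def vectorForm (M : CStarInnerProductModule A E) (π : A →⋆ₙₐ[ℂ] (H →L[ℂ] H))
    (ξ : H) (x y : E) : ℂ :=
  Inner.inner ℂ ξ (π (M.inner x y) ξ)

variable (M : CStarInnerProductModule A E) (π : A →⋆ₙₐ[ℂ] (H →L[ℂ] H)) (ξ : H)

theorem vectorForm_add_left (x y z : E) :
    M.vectorForm π ξ (x + y) z = M.vectorForm π ξ x z + M.vectorForm π ξ y z := by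
  simp [vectorForm, M.add_left]

theorem vectorForm_smul_left (c : ℂ) (x y : E) :
    M.vectorForm π ξ (c • x) y = c * M.vectorForm π ξ x y := by
  simp [vectorForm, M.smulC_left]

theorem star_vectorForm (x y : E) :
    star (M.vectorForm π ξ x y) = M.vectorForm π ξ y x := by
  rw [vectorForm, vectorForm, ← M.star_inner x y, map_star, ContinuousLinearMap.star_eq_adjoint,
    ContinuousLinearMap.adjoint_inner_right]
  exact inner_conj_symm _ _

theorem exists_vectorForm_self_eq_ofReal (x : E) :
    ∃ r : ℝ, 0 ≤ r ∧ M.vectorForm π ξ x x = r := by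
  obtain ⟨b, hb⟩ := CStarAlgebra.nonneg_iff_eq_star_mul_self.mp (M.inner_self_nonneg x)
  refine ⟨‖π b ξ‖ ^ 2, sq_nonneg _, ?_⟩
  rw [vectorForm, hb, map_mul, map_star, ContinuousLinearMap.star_eq_adjoint,
    mul_apply_eq_comp, ContinuousLinearMap.adjoint_inner_right,
    inner_self_eq_norm_sq_to_K]
  norm_cast

/-- Matrix coefficients of an inner product are values of the form attached to a unit vector. -/
theorem vectorForm_smul_smul (hξ : ‖ξ‖ = 1) {a b : A} {η ζ : H}
    (ha : π a = rankOne ℂ ξ η) (hb : π b = rankOne ℂ ξ ζ) (x y : E) :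
    M.vectorForm π ξ (a • x) (b • y) = Inner.inner ℂ η (π (M.inner x y) ζ) := by
  simp [vectorForm, M.inner_smul_smul, ha, hb, map_star, ContinuousLinearMap.star_eq_adjoint, hξ]

/-- Compressing by a rank-one projection turns the inner product into the scalar form. -/
theorem map_inner_smul_smul {e : A} (he : π e = rankOne ℂ ξ ξ) (x y : E) :
    π (M.inner (e • x) (e • y)) = M.vectorForm π ξ x y • rankOne ℂ ξ ξ := by
  ext v
  simp [vectorForm, M.inner_smul_smul, he, map_star, ContinuousLinearMap.star_eq_adjoint,
    smul_smul, mul_comm]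

end CStarInnerProductModule

/-- **Corollary 3.6**: let `A` be a standard C*-algebra on a Hilbert space `H` (realized via an
isometric star homomorphism `π : A → B(H)` whose range contains all compact operators) and let
`E` be a nonzero `A`-module carrying two `A`-valued inner products `⟪·,·⟫₁` and `⟪·,·⟫₂`.
If `⟪x, y⟫₁ = 0` implies `⟪x, y⟫₂ = 0`, then `⟪·,·⟫₂ = γ • ⟪·,·⟫₁` for some positive real
constant `γ`. -/
theorem second_inner_product_is_positive_multiple
    {H : Type*} [NormedAddCommGroup H] [InnerProductSpace ℂ H] [CompleteSpace H]
    {A E : Type*} [NonUnitalCStarAlgebra A] [PartialOrder A] [StarOrderedRing A]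
    (π : A →⋆ₙₐ[ℂ] (H →L[ℂ] H)) (hπ : Isometry π)
    (hcpt : ∀ f : H →L[ℂ] H, IsCompactOperator (⇑f) → f ∈ Set.range π)
    [AddCommGroup E] [Module ℂ E] [SMul A E]
    (hE : ∃ x : E, x ≠ 0)
    (M₁ M₂ : CStarInnerProductModule A E)
    (h : ∀ x y : E, M₁.inner x y = 0 → M₂.inner x y = 0) :
    ∃ γ : ℝ, 0 < γ ∧ ∀ x y : E, M₂.inner x y = γ • M₁.inner x y := by
  obtain ⟨x₀, hx₀⟩ := hE
  have hinj : Function.Injective π := hπ.injective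
  have hπ₀ {a : A} (ha : π a = 0) : a = 0 := hinj (ha.trans (map_zero π).symm)
  have hnz : π (M₁.inner x₀ x₀) ≠ 0 := fun h0 ↦
    hx₀ ((M₁.inner_self_eq_zero x₀).mp (hπ₀ h0))
  obtain ⟨ξ, hξ⟩ : ∃ ξ : H, ‖ξ‖ = 1 := by
    obtain ⟨v, hv⟩ : ∃ v, π (M₁.inner x₀ x₀) v ≠ 0 := by
      by_contra! h0
      exact hnz (ContinuousLinearMap.ext h0)
    have : Nontrivial H := ⟨_, _, hv⟩
    exact exists_norm_eq H zero_le_one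
  have hrank (η : H) : ∃ a : A, π a = InnerProductSpace.rankOne ℂ ξ η :=
    hcpt _ (isCompactOperator_rankOne ξ η)
  choose a ha using hrank
  have hξ₀ : InnerProductSpace.rankOne ℂ ξ ξ ≠ 0 := by
    have : ξ ≠ 0 := by rintro rfl; simp at hξ
    simpa using this
  have form_eq_zero (M : CStarInnerProductModule A E) (x y : E) :
      M.vectorForm π ξ x y = 0 ↔ M.inner (a ξ • x) (a ξ • y) = 0 := by
    have hmap := M.map_inner_smul_smul π ξ (ha ξ) x y
    refine ⟨fun h0 ↦ hπ₀ (by rw [hmap, h0, zero_smul]), fun h0 ↦ ?_⟩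
    rw [h0, map_zero] at hmap
    exact (smul_eq_zero.mp hmap.symm).resolve_right hξ₀
  have form_radical (M N : CStarInnerProductModule A E) (x y : E)
      (hy : M.vectorForm π ξ y y = 0) : N.vectorForm π ξ x y = 0 := by
    rw [form_eq_zero, M.inner_self_eq_zero] at hy
    rw [form_eq_zero, hy, N.inner_zero_right]
  obtain ⟨c, hc⟩ := exists_eq_mul_of_orthogonal_imp (M₁.vectorForm π ξ) (M₂.vectorForm π ξ)
    (M₁.vectorForm_add_left π ξ) (M₁.vectorForm_smul_left π ξ) (M₁.star_vectorForm π ξ)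
    (M₂.vectorForm_add_left π ξ) (M₂.vectorForm_smul_left π ξ) (M₂.star_vectorForm π ξ)
    (form_radical M₁ M₁) (fun x y h0 ↦ (form_eq_zero M₂ x y).mpr
      (h _ _ ((form_eq_zero M₁ x y).mp h0)))
  have inner_eq (x y : E) : M₂.inner x y = c • M₁.inner x y := by
    refine hinj (ContinuousLinearMap.ext fun ζ ↦ ext_inner_left ℂ fun η ↦ ?_)
    have hηζ := hc (a η • x) (a ζ • y)
    rw [M₁.vectorForm_smul_smul π ξ hξ (ha η) (ha ζ),
      M₂.vectorForm_smul_smul π ξ hξ (ha η) (ha ζ)] at hηζ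
    rw [hηζ, map_smul, smul_apply, inner_smul_right]
  obtain ⟨u, hu⟩ : ∃ u, M₁.vectorForm π ξ u u ≠ 0 := by
    by_contra! h0
    refine hnz (ContinuousLinearMap.ext fun ζ ↦ ext_inner_left ℂ fun η ↦ ?_)
    rw [← M₁.vectorForm_smul_smul π ξ hξ (ha η) (ha ζ), form_radical M₁ M₁ _ _ (h0 _),
      zero_apply, inner_zero_right]
  have hu₂ : M₂.vectorForm π ξ u u ≠ 0 := fun h0 ↦ hu (form_radical M₂ M₁ u u h0)
  obtain ⟨r, hr, hur⟩ := M₁.exists_vectorForm_self_eq_ofReal π ξ u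
  obtain ⟨s, hs, hus⟩ := M₂.exists_vectorForm_self_eq_ofReal π ξ u
  rw [hur] at hu
  rw [hus] at hu₂
  have hcu : c = ((s / r : ℝ) : ℂ) := by
    rw [Complex.ofReal_div, ← hus, hc, hur, mul_div_cancel_right₀ _ hu]
  refine ⟨s / r, div_pos (hs.lt_of_ne' (by exact_mod_cast hu₂))
    (hr.lt_of_ne' (by exact_mod_cast hu)), fun x y ↦ ?_⟩
  rw [inner_eq, hcu, Complex.coe_smul]
end

section
/- Let A be a standard C*-algebra on a Hilbert space H and let E, F be inner product A-modules. Let T₀, S₀ : E → F be nonzero local mappings such that ⟨x, y⟩ = 0 implies ⟨T₀(x), S₀(y)⟩ = 0 for all x, y ∈ E. Let θ₁, θ₂ ∈ [0, 1) and suppose T, S : E → F are linear mappings satisfying ‖T(x) − T₀(x)‖ ≤ θ₁‖T(x)‖ and ‖S(y) − S₀(y)‖ ≤ θ₂‖S(y)‖ for all x, y ∈ E. Then for all x, y ∈ E with ⟨x, y⟩ = 0 one has ‖⟨T(x), S(y)⟩‖ ≤ ε·‖T(x)‖·‖S(y)‖, where ε = θ₁θ₂ + θ₁(θ₂ + 1)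 + (θ₁ + 1)θ₂. -/
/-- A normed inner product module over a C*-algebra `A`: a (left) `A`-module `E` together with
an `A`-valued inner product which is `ℂ`-linear and `A`-linear in the first variable, conjugate
symmetric, and positive definite, whose induced norm `‖x‖ = ‖⟪x, x⟫‖^(1/2)` is the norm of
`E`. -/
structure CStarNormedInnerProductModule (A E : Type*) [NonUnitalCStarAlgebra A]
    [PartialOrder A] [StarOrderedRing A]
    [NormedAddCommGroup E] [Module ℂ E] [SMul A E] where
  inner : E → E → A
  add_left : ∀ x y z : E, inner (x + y) z = inner x z + inner y z
  smulC_left : ∀ (c : ℂ) (x y : E), inner (c • x) y = c • inner x y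
  smulA_left : ∀ (a : A) (x y : E), inner (a • x) y = a * inner x y
  star_inner : ∀ x y : E, star (inner x y) = inner y x
  inner_self_nonneg : ∀ x : E, 0 ≤ inner x x
  inner_self_eq_zero : ∀ x : E, inner x x = 0 ↔ x = 0
  smul_add : ∀ (a : A) (x y : E), a • (x + y) = a • x + a • y
  add_smul : ∀ (a b : A) (x : E), (a + b) • x = a • x + b • x
  mul_smul : ∀ (a b : A) (x : E), (a * b) • x = a • (b • x)
  smul_assoc : ∀ (c : ℂ) (a : A) (x : E), (c • a) • x = c • (a • x)
  norm_eq : ∀ x : E, ‖x‖ ^ 2 = ‖inner x x‖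

namespace CStarNormedInnerProductModule

variable {A E : Type*} [NonUnitalCStarAlgebra A] [PartialOrder A] [StarOrderedRing A]
  [NormedAddCommGroup E] [Module ℂ E] [SMul A E] (M : CStarNormedInnerProductModule A E)

/-- The `CStarModule` structure obtained by exchanging the arguments of the inner product. -/
@[reducible]
def toCStarModule : CStarModule A E where
  inner x y := M.inner y x
  inner_add_right := M.add_left _ _ _
  inner_self_nonneg := M.inner_self_nonneg _
  inner_self := M.inner_self_eq_zero _
  inner_op_smul_right := M.smulA_left _ _ _
  inner_smul_right_complex := M.smulC_left _ _ _
  star_inner x y := M.star_inner y x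
  norm_eq_sqrt_norm_inner_self x := by rw [← M.norm_eq, Real.sqrt_sq (norm_nonneg x)]

/-- The Cauchy-Schwarz inequality. -/
theorem norm_inner_le (x y : E) : ‖M.inner x y‖ ≤ ‖x‖ * ‖y‖ := by
  let := M.toCStarModule
  rw [mul_comm]
  exact CStarModule.norm_inner_le (A := A) E (x := y) (y := x)

theorem add_right (x y z : E) : M.inner x (y + z) = M.inner x y + M.inner x z := by
  rw [← M.star_inner, M.add_left, star_add, M.star_inner, M.star_inner]

/-- If `u₀` and `v₀` are orthogonal, the inner product of `u` and `v` is controlled by the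
distances from `u` to `u₀` and from `v` to `v₀`. -/
theorem norm_inner_le_of_inner_eq_zero {u₀ v₀ : E} (h : M.inner u₀ v₀ = 0) (u v : E) :
    ‖M.inner u v‖ ≤ ‖u - u₀‖ * ‖v - v₀‖ + ‖u - u₀‖ * ‖v₀‖ + ‖u₀‖ * ‖v - v₀‖ := by
  have key : M.inner u v =
      M.inner (u - u₀) (v - v₀) + M.inner (u - u₀) v₀ + M.inner u₀ (v - v₀) := by
    conv_lhs => rw [← sub_add_cancel u u₀, ← sub_add_cancel v v₀]
    rw [M.add_left, M.add_right, M.add_right, h, add_zero]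
  rw [key]
  refine norm_add₃_le.trans ?_
  gcongr <;> exact M.norm_inner_le _ _

end CStarNormedInnerProductModule

/-- **Corollary 3.11**: stability of the orthogonality preserving property.  If `T₀, S₀` are
nonzero local orthogonality preserving mappings and the linear maps `T, S` satisfy
`‖T x − T₀ x‖ ≤ θ₁ ‖T x‖` and `‖S y − S₀ y‖ ≤ θ₂ ‖S y‖`, then `(T, S)` is approximately
orthogonality preserving: `⟪x, y⟫ = 0` implies `‖⟪T x, S y⟫‖ ≤ ε ‖T x‖ ‖S y‖`, where
`ε = θ₁θ₂ + θ₁(θ₂ + 1) + (θ₁ + 1)θ₂`. -/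
theorem approximate_orthogonality_preserving_of_close_to_local_pair
    {H : Type*} [NormedAddCommGroup H] [InnerProductSpace ℂ H] [CompleteSpace H]
    {A E F : Type*} [NonUnitalCStarAlgebra A] [PartialOrder A] [StarOrderedRing A]
    (π : A →⋆ₙₐ[ℂ] (H →L[ℂ] H)) (hπ : Isometry π)
    (hcpt : ∀ f : H →L[ℂ] H, IsCompactOperator (⇑f) → f ∈ Set.range π)
    [NormedAddCommGroup E] [Module ℂ E] [SMul A E]
    [NormedAddCommGroup F] [Module ℂ F] [SMul A F]
    (ME : CStarNormedInnerProductModule A E) (MF : CStarNormedInnerProductModule A F)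
    (T₀ S₀ : E → F) (hT₀ : T₀ ≠ 0) (hS₀ : S₀ ≠ 0)
    (hT₀add : ∀ x y : E, T₀ (x + y) = T₀ x + T₀ y)
    (hT₀smulC : ∀ (c : ℂ) (x : E), T₀ (c • x) = c • T₀ x)
    (hT₀local : ∀ (a : A) (x : E), a • x = 0 → a • T₀ x = 0)
    (hS₀add : ∀ x y : E, S₀ (x + y) = S₀ x + S₀ y)
    (hS₀smulC : ∀ (c : ℂ) (x : E), S₀ (c • x) = c • S₀ x)
    (hS₀local : ∀ (a : A) (x : E), a • x = 0 → a • S₀ x = 0)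
    (hT₀S₀ : ∀ x y : E, ME.inner x y = 0 → MF.inner (T₀ x) (S₀ y) = 0)
    (θ₁ θ₂ : ℝ) (hθ₁ : θ₁ ∈ Set.Ico (0 : ℝ) 1) (hθ₂ : θ₂ ∈ Set.Ico (0 : ℝ) 1)
    (T S : E →ₗ[ℂ] F)
    (hTT₀ : ∀ x : E, ‖T x - T₀ x‖ ≤ θ₁ * ‖T x‖)
    (hSS₀ : ∀ y : E, ‖S y - S₀ y‖ ≤ θ₂ * ‖S y‖) :
    ∀ x y : E, ME.inner x y = 0 →
      ‖MF.inner (T x) (S y)‖ ≤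
        (θ₁ * θ₂ + θ₁ * (θ₂ + 1) + (θ₁ + 1) * θ₂) * (‖T x‖ * ‖S y‖) := by
  intro x y hxy
  have norm_approx_le : ∀ (u u₀ : F) (θ : ℝ), ‖u - u₀‖ ≤ θ * ‖u‖ → ‖u₀‖ ≤ (θ + 1) * ‖u‖ := by
    intro u u₀ θ h
    linarith [norm_sub_norm_le u₀ u, norm_sub_rev u u₀]
  have hθ₁' := hθ₁.1
  have hT := hTT₀ x
  have hS := hSS₀ y
  calc ‖MF.inner (T x) (S y)‖
      ≤ ‖T x - T₀ x‖ * ‖S y - S₀ y‖ + ‖T x - T₀ x‖ * ‖S₀ y‖ + ‖T₀ x‖ * ‖S y - S₀ y‖ :=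
        MF.norm_inner_le_of_inner_eq_zero (hT₀S₀ x y hxy) _ _
    _ ≤ (θ₁ * ‖T x‖) * (θ₂ * ‖S y‖) + (θ₁ * ‖T x‖) * ((θ₂ + 1) * ‖S y‖) +
          ((θ₁ + 1) * ‖T x‖) * (θ₂ * ‖S y‖) := by
        gcongr
        · exact norm_approx_le _ _ _ hS
        · exact norm_approx_le _ _ _ hT
    _ = (θ₁ * θ₂ + θ₁ * (θ₂ + 1) + (θ₁ + 1) * θ₂) * (‖T x‖ * ‖S y‖) := by ring
end
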